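/- Fix a label class i, parameters η ≥ 0, q ≥ 0, c > 0, and a class F of classifiers f : X → Y. Suppose the collection M_η = { R_η(f) ∩ {x ∈ T_i ∩ D_hard : f(x) ≠ y(x)} : f ∈ F } satisfies (c,q,η)-robust expansion on (S_i^good ∩ D_overlap, T_i ∩ D_hard). Then every classifier f ∈ F satisfies err(f, y | T_i ∩ D_hard) ≤ P(R_η(f)^c | T_i ∩ D_hard) + max( q, err(f, f_weak | S_i ∩ D_overlap) / (c(1 − ε₁)) ). -/

import Mathlib

/-!
Framework: finite probability space, neighborhoods, robust expansion
(following Lang et al. 2024), pseudolabelers and easy/hard/overlap partition.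
-/

open Set

/-- Probability of a set `A` under a mass function `p` on a finite type. -/
noncomputable def pr {X : Type*} [Fintype X] (p : X → ℝ) (A : Set X) : ℝ :=
  ∑ x, A.indicator p x

/-- Conditional probability `P(A | B)`. -/
noncomputable def cpr {X : Type*} [Fintype X] (p : X → ℝ) (A B : Set X) : ℝ :=
  pr p (A ∩ B) / pr p B

/-- Neighborhood of a set: `N(A) = ⋃_{x ∈ A} N(x)`. -/
def nbhdSet {X : Type*} (N : X → Set X) (A : Set X) : Set X :=
  ⋃ x ∈ A, N x

/-- Total edge weight between sets: `w(V,U) = ∑_{x ∈ V, x' ∈ U} P(x)P(x')𝟙[x ∈ N(x')]`. -/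
noncomputable def wSet {X : Type*} [Fintype X] (p : X → ℝ) (N : X → Set X)
    (V U : Set X) : ℝ :=
  ∑ x, ∑ x', V.indicator p x * U.indicator p x' * (N x').indicator (fun _ => (1 : ℝ)) x

/-- Robustness `r(f,x) = P(f(x') ≠ f(x) | x' ∈ N(x))`. -/
noncomputable def rob {X Y : Type*} [Fintype X] (p : X → ℝ) (N : X → Set X)
    (f : X → Y) (x : X) : ℝ :=
  cpr p {x' | f x' ≠ f x} (N x)

/-- The set of `η`-robust points `R_η(f)`. -/
def Reta {X Y : Type*} [Fintype X] (p : X → ℝ) (N : X → Set X) (η : ℝ)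
    (f : X → Y) : Set X :=
  {x | rob p N f x ≤ η}

/-- `η`-robust neighborhood size
`P_{1-η}(U,A) = min { P(V|A) : w(V,U) ≥ (1-η) w(N(U),U) }`. -/
noncomputable def robNbhd {X : Type*} [Fintype X] (p : X → ℝ) (N : X → Set X)
    (η : ℝ) (U A : Set X) : ℝ :=
  sInf {r : ℝ | ∃ V : Set X,
    (1 - η) * wSet p N (nbhdSet N U) U ≤ wSet p N V U ∧ r = cpr p V A}

/-- A collection `M` of subsets of `B` satisfies `(c,q,η)`-robust expansion on `(A,B)`. -/
def RobustExpansion {X : Type*} [Fintype X] (p : X → ℝ) (N : X → Set X)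
    (c q η : ℝ) (M : Set (Set X)) (A B : Set X) : Prop :=
  ∀ U ∈ M, q < cpr p U B → c * cpr p U B < robNbhd p N η U A


lemma pr_nonneg {X : Type*} [Fintype X] {p : X → ℝ} (hp : ∀ x, 0 ≤ p x) (A : Set X) :
    0 ≤ pr p A :=
  Finset.sum_nonneg fun x _ => Set.indicator_nonneg (fun x _ => hp x) x

lemma pr_mono {X : Type*} [Fintype X] {p : X → ℝ} (hp : ∀ x, 0 ≤ p x) {A B : Set X}
    (h : A ⊆ B) : pr p A ≤ pr p B :=
  Finset.sum_le_sum fun x _ => Set.indicator_le_indicator_of_subset h hp x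

lemma pr_inter_add_diff {X : Type*} [Fintype X] (p : X → ℝ) (A B : Set X) :
    pr p (A ∩ B) + pr p (A \ B) = pr p A := by
  classical
  simp only [pr, ← Finset.sum_add_distrib]
  refine Finset.sum_congr rfl fun x _ => ?_
  by_cases hA : x ∈ A <;> by_cases hB : x ∈ B <;> simp [Set.indicator, hA, hB]

lemma cpr_nonneg {X : Type*} [Fintype X] {p : X → ℝ} (hp : ∀ x, 0 ≤ p x) (A B : Set X) :
    0 ≤ cpr p A B :=
  div_nonneg (pr_nonneg hp _) (pr_nonneg hp _)

lemma cpr_mul_pr {X : Type*} [Fintype X] {p : X → ℝ} (hp : ∀ x, 0 ≤ p x) (A B : Set X) :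
    cpr p A B * pr p B = pr p (A ∩ B) := by
  rcases eq_or_ne (pr p B) 0 with h | h
  · have h₁ := pr_mono hp (inter_subset_right : A ∩ B ⊆ B)
    rw [h, mul_zero]
    exact le_antisymm (pr_nonneg hp _) (h ▸ h₁)
  · exact div_mul_cancel₀ _ h

lemma cpr_le_cpr_compl_add_cpr {X : Type*} [Fintype X] {p : X → ℝ} (hp : ∀ x, 0 ≤ p x)
    (R E B : Set X) : cpr p E B ≤ cpr p Rᶜ B + cpr p (R ∩ {x ∈ B | x ∈ E}) B := by
  unfold cpr
  rw [← add_div]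
  refine div_le_div_of_nonneg_right ?_ (pr_nonneg hp _)
  rw [← pr_inter_add_diff p (E ∩ B) R, add_comm]
  refine add_le_add (pr_mono hp ?_) (pr_mono hp ?_)
  · rintro x ⟨⟨-, hB⟩, hR⟩
    exact ⟨hR, hB⟩
  · rintro x ⟨⟨hE, hB⟩, hR⟩
    exact ⟨⟨hR, hB, hE⟩, hB⟩

lemma wSet_eq_sum {X : Type*} [Fintype X] (p : X → ℝ) (N : X → Set X) (V U : Set X) :
    wSet p N V U = ∑ x, U.indicator p x * pr p (V ∩ N x) := by
  classical
  unfold wSet pr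
  rw [Finset.sum_comm]
  refine Finset.sum_congr rfl fun x' _ => ?_
  rw [Finset.mul_sum]
  refine Finset.sum_congr rfl fun x _ => ?_
  by_cases hV : x ∈ V <;> by_cases hN : x ∈ N x' <;> simp [Set.indicator, hV, hN, mul_comm]

/-- Points where `f` takes a value other than `i` cover a `1 - η` fraction of the edge weight at
any set of `η`-robust such points. -/
lemma one_sub_mul_wSet_nbhdSet_le {X Y : Type*} [Fintype X] {p : X → ℝ} (hp : ∀ x, 0 ≤ p x)
    (N : X → Set X) (η : ℝ) (f : X → Y) (i : Y) {U : Set X} (hR : U ⊆ Reta p N η f)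
    (hU : ∀ x ∈ U, f x ≠ i) :
    (1 - η) * wSet p N (nbhdSet N U) U ≤ wSet p N {x | f x ≠ i} U := by
  rw [wSet_eq_sum, wSet_eq_sum, Finset.mul_sum]
  refine Finset.sum_le_sum fun x _ => ?_
  by_cases hx : x ∈ U
  · have hN : nbhdSet N U ∩ N x = N x :=
      inter_eq_right.2 (Set.subset_biUnion_of_mem (u := N) hx)
    have hrob : pr p ({x' | f x' ≠ f x} ∩ N x) ≤ η * pr p (N x) := by
      rw [← cpr_mul_pr hp]
      exact mul_le_mul_of_nonneg_right (hR hx) (pr_nonneg hp _)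
    have hsplit := pr_inter_add_diff p (N x) {x' | f x' ≠ f x}
    have hsub : pr p (N x \ {x' | f x' ≠ f x}) ≤ pr p ({x | f x ≠ i} ∩ N x) := by
      refine pr_mono hp ?_
      rintro z ⟨hz, hzf⟩
      have hzf' : f z = f x := not_not.1 hzf
      exact ⟨fun h => hU x hx (hzf' ▸ h), hz⟩
    rw [inter_comm] at hsplit
    rw [hN, Set.indicator_of_mem hx, mul_left_comm]
    exact mul_le_mul_of_nonneg_left (by linarith) (hp x)
  · simp [hx]

lemma robNbhd_le {X : Type*} [Fintype X] {p : X → ℝ} (hp : ∀ x, 0 ≤ p x) (N : X → Set X)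
    (η : ℝ) {U V : Set X} (A : Set X)
    (h : (1 - η) * wSet p N (nbhdSet N U) U ≤ wSet p N V U) :
    robNbhd p N η U A ≤ cpr p V A := by
  refine csInf_le ⟨0, ?_⟩ ⟨V, h, rfl⟩
  rintro _ ⟨W, -, rfl⟩
  exact cpr_nonneg hp W A

theorem coverage_expansion
    {X Y : Type*} [Fintype X]
    (p : X → ℝ) (hp0 : ∀ x, 0 ≤ p x) (hp1 : ∑ x, p x = 1)
    (N : X → Set X) (hNsymm : ∀ x x', x ∈ N x' ↔ x' ∈ N x)
    (y : X → Y) (fw : X → Option Y)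
    (Deasy Dhard Dover : Set X)
    (hcover : Deasy ∪ Dhard ∪ Dover = Set.univ)
    (hdis1 : Disjoint Deasy Dhard) (hdis2 : Disjoint Deasy Dover)
    (hdis3 : Disjoint Dhard Dover)
    (i : Y)
    (S T Si Ti Sgood Sbad : Set X)
    (hS : S = {x | fw x ≠ none})
    (hT : T = Sᶜ)
    (hSi : Si = {x ∈ S | y x = i})
    (hTi : Ti = {x ∈ T | y x = i})
    (hSgood : Sgood = {x ∈ Si | fw x = some (y x)})
    (hSbad : Sbad = Si \ Sgood)
    (ε₁ ε₂ : ℝ)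
    (hε₁ : ε₁ = cpr p {x | fw x ≠ some (y x)} (Si ∩ Dover))
    (hε₁' : ε₁ = cpr p {x | fw x ≠ some (y x)} (Si ∩ Deasy))
    (hε₂ : ε₂ = cpr p {x | fw x ≠ some (y x)} (Si ∩ Dhard))
    (hε₁pos : 0 < ε₁) (hε₁₂ : ε₁ ≤ ε₂) (hε₂half : ε₂ ≤ 1 / 2)
    (η q c : ℝ) (hη : 0 ≤ η) (hq : 0 ≤ q) (hc : 0 < c)
    (F : Set (X → Y))
    (hexp : RobustExpansion p N c q η
      ((fun f => Reta p N η f ∩ {x ∈ Ti ∩ Dhard | f x ≠ y x}) '' F)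
      (Sgood ∩ Dover) (Ti ∩ Dhard))
    (f : X → Y) (hfF : f ∈ F) :
    cpr p {x | f x ≠ y x} (Ti ∩ Dhard)
      ≤ cpr p (Reta p N η f)ᶜ (Ti ∩ Dhard)
        + max q (cpr p {x | some (f x) ≠ fw x} (Si ∩ Dover) / (c * (1 - ε₁))) := by
  refine (cpr_le_cpr_compl_add_cpr hp0 (Reta p N η f) _ _).trans ?_
  gcongr
  set U := Reta p N η f ∩ {x ∈ Ti ∩ Dhard | f x ≠ y x}
  change cpr p U (Ti ∩ Dhard) ≤ _
  rcases le_or_gt (cpr p U (Ti ∩ Dhard)) q with h | h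
  · exact h.trans (le_max_left _ _)
  refine le_trans ?_ (le_max_right _ _)
  have hexpU := hexp U ⟨f, hfF, rfl⟩ h
  have hUi : ∀ x ∈ U, f x ≠ i := by
    rintro x ⟨-, ⟨hx, -⟩, hfx⟩
    rw [hTi] at hx
    exact hx.2 ▸ hfx
  have hrob := robNbhd_le hp0 N η (Sgood ∩ Dover)
    (one_sub_mul_wSet_nbhdSet_le hp0 N η f i inter_subset_left hUi)
  have hε : 0 < 1 - ε₁ := by linarith
  have hpos : 0 < pr p (Si ∩ Dover) := by
    refine (pr_nonneg hp0 _).lt_of_ne' fun h0 => ?_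
    simp [cpr, h0] at hε₁
    exact hε₁pos.ne' hε₁
  have hgood : pr p (Sgood ∩ Dover) = (1 - ε₁) * pr p (Si ∩ Dover) := by
    have hbad := cpr_mul_pr hp0 {x | fw x ≠ some (y x)} (Si ∩ Dover)
    rw [← hε₁] at hbad
    have hsplit := pr_inter_add_diff p (Si ∩ Dover) {x | fw x ≠ some (y x)}
    have hset : (Si ∩ Dover) \ {x | fw x ≠ some (y x)} = Sgood ∩ Dover := by
      ext x
      simp only [hSgood, mem_sdiff, mem_inter_iff, mem_ofPred_eq, not_not]
      tauto
    rw [hset, inter_comm] at hsplit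
    linarith
  have hle : cpr p {x | f x ≠ i} (Sgood ∩ Dover)
      ≤ cpr p {x | some (f x) ≠ fw x} (Si ∩ Dover) / (1 - ε₁) := by
    unfold cpr
    rw [hgood, div_div, mul_comm (1 - ε₁)]
    refine div_le_div_of_nonneg_right (pr_mono hp0 ?_) (by positivity)
    rintro x ⟨hfx, hx, hxD⟩
    rw [hSgood] at hx
    obtain ⟨hxS, hw⟩ := hx
    have hy : y x = i := by
      rw [hSi] at hxS
      exact hxS.2
    refine ⟨fun heq => hfx ?_, hxS, hxD⟩
    rw [hw] at heq
    exact (Option.some.inj heq).trans hy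
  rw [mul_comm c, ← div_div, le_div_iff₀ hc]
  linarith
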